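/- arXiv:2605.22430 — 5 statements merged into one kernel-verified Lean document; each statement's English description precedes it below -/
import Mathlib

section
/- Every group G possesses an amenable radical: there exists an amenable normal subgroup R of G that contains every amenable normal subgroup of G (equivalently, R is the largest amenable normal subgroup of G). -/
/-- A group `N` is amenable if it admits a finitely additive, left-invariant
probability measure defined on all subsets of `N`. -/
def IsAmenable (N : Type*) [Group N] : Prop :=
  ∃ m : Set N → ℝ,
    m ∅ = 0 ∧
    m Set.univ = 1 ∧
    (∀ A B : Set N, Disjoint A B → m (A ∪ B) = m A + m B) ∧
    (∀ (g : N) (A : Set N), m ((fun x => g * x) '' A) = m A)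

open Filter Topology
open scoped Pointwise

/-- A finitely additive normalized functional on the `[0, 1]`-valued functions on `X`. -/
structure IsMean {X : Type*} (M : (X → ℝ) → ℝ) : Prop where
  mem_Icc : ∀ f : X → ℝ, (∀ x, f x ∈ Set.Icc 0 1) → M f ∈ Set.Icc 0 1
  one : M (fun _ => 1) = 1
  add : ∀ f g : X → ℝ, (∀ x, f x ∈ Set.Icc 0 1) → (∀ x, g x ∈ Set.Icc 0 1) →
    (∀ x, f x + g x ∈ Set.Icc 0 1) → M (fun x => f x + g x) = M f + M g

/-- A group has an invariant mean if some mean on it is invariant under left translations. -/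
def HasInvariantMean (N : Type*) [Group N] : Prop :=
  ∃ M : (N → ℝ) → ℝ, IsMean M ∧
    ∀ (g : N) (f : N → ℝ), (∀ x, f x ∈ Set.Icc 0 1) → M (fun x => f (g * x)) = M f

theorem HasInvariantMean.isAmenable {N : Type*} [Group N] (h : HasInvariantMean N) :
    IsAmenable N := by
  classical
  obtain ⟨M, hM, hinv⟩ := h
  have hind : ∀ (A : Set N) (x : N), A.indicator (fun _ => (1 : ℝ)) x ∈ Set.Icc 0 1 := by
    intro A x
    by_cases hx : x ∈ A <;> simp [hx]
  refine ⟨fun A => M (A.indicator fun _ => 1), ?_, ?_, ?_, ?_⟩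
  · have := hM.add (fun _ => 0) (fun _ => 0) (by simp) (by simp) (by simp)
    simpa using this
  · simpa using hM.one
  · intro A B hAB
    beta_reduce
    rw [Set.indicator_union_of_disjoint hAB]
    refine hM.add _ _ (hind A) (hind B) fun x => ?_
    have := hind (A ∪ B) x
    rwa [Set.indicator_union_of_disjoint hAB] at this
  · intro g A
    beta_reduce
    rw [← hinv g _ (hind (_ '' A))]
    congr 1
    ext x
    simp [Set.indicator]

/-- An asymptotically invariant family of means yields an invariant mean. -/
theorem HasInvariantMean.of_tendsto {N ι : Type*} [Group N] (l : Filter ι) [l.NeBot]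
    (M : ι → (N → ℝ) → ℝ) (hM : ∀ i, IsMean (M i))
    (hinv : ∀ (g : N) (f : N → ℝ), (∀ x, f x ∈ Set.Icc 0 1) →
      Tendsto (fun i => M i (fun x => f (g * x)) - M i f) l (𝓝 0)) :
    HasInvariantMean N := by
  have hlim : ∀ f : N → ℝ, ∃ a : ℝ, (∀ x, f x ∈ Set.Icc 0 1) →
      a ∈ Set.Icc 0 1 ∧ Tendsto (fun i => M i f) (Ultrafilter.of l) (𝓝 a) := by
    intro f
    by_cases hf : ∀ x, f x ∈ Set.Icc 0 1
    · obtain ⟨a, ha, h⟩ := (isCompact_Icc (a := (0 : ℝ)) (b := 1)).ultrafilter_le_nhds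
        ((Ultrafilter.of l).map fun i => M i f)
        (le_principal_iff.2 (Filter.mem_map.2 (Filter.univ_mem' fun i => (hM i).mem_Icc f hf)))
      exact ⟨a, fun _ => ⟨ha, h⟩⟩
    · exact ⟨0, fun h => absurd h hf⟩
  choose L hL using hlim
  refine ⟨L, ⟨fun f hf => (hL f hf).1, ?_, ?_⟩, ?_⟩
  · have h := (hL (fun _ => 1) (by simp)).2
    simp only [(hM _).one] at h
    exact tendsto_nhds_unique h tendsto_const_nhds
  · intro f g hf hg hfg
    have h := (hL (fun x => f x + g x) hfg).2
    simp only [(hM _).add f g hf hg hfg] at h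
    exact tendsto_nhds_unique h ((hL f hf).2.add (hL g hg).2)
  · intro g f hf
    have h := (hinv g f hf).mono_left (Ultrafilter.of_le l)
    have h' := (hL (fun x => f (g * x)) fun x => hf _).2.sub (hL f hf).2
    exact sub_eq_zero.1 (tendsto_nhds_unique h' h)

theorem HasInvariantMean.sup {G : Type*} [Group G] (H N : Subgroup G) [N.Normal]
    (hH : HasInvariantMean H) (hN : HasInvariantMean N) :
    HasInvariantMean (H ⊔ N : Subgroup G) := by
  obtain ⟨ν, hν, hνinv⟩ := hH
  obtain ⟨μ, hμ, hμinv⟩ := hN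
  let p : H → N → (H ⊔ N : Subgroup G) := fun b n =>
    ⟨b * n, mul_mem ((le_sup_left : H ≤ H ⊔ N) b.2) ((le_sup_right : N ≤ H ⊔ N) n.2)⟩
  refine ⟨fun f => ν fun b => μ fun n => f (p b n), ⟨?_, ?_, ?_⟩, ?_⟩
  · exact fun f hf => hν.mem_Icc _ fun b => hμ.mem_Icc _ fun n => hf _
  · simp only [hμ.one, hν.one]
  · intro f g hf hg hfg
    have h : ∀ b, μ (fun n => f (p b n) + g (p b n)) =
        μ (fun n => f (p b n)) + μ fun n => g (p b n) := fun b =>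
      hμ.add _ _ (fun n => hf _) (fun n => hg _) fun n => hfg _
    simp only [h]
    refine hν.add _ _ (fun b => hμ.mem_Icc _ fun n => hf _)
      (fun b => hμ.mem_Icc _ fun n => hg _) fun b => ?_
    rw [← h]
    exact hμ.mem_Icc _ fun n => hfg _
  · rintro ⟨g, hg⟩ f hf
    obtain ⟨h₀, hh₀, n₀, hn₀, rfl⟩ := Subgroup.mem_sup_of_normal_right.1 hg
    refine Eq.trans ?_ (hνinv ⟨h₀, hh₀⟩ (fun b => μ fun n => f (p b n))
      fun b => hμ.mem_Icc _ fun n => hf _)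
    refine congrArg ν (funext fun b => ?_)
    have hc : (b : G)⁻¹ * n₀ * b ∈ N := by
      simpa using Subgroup.Normal.conj_mem ‹_› n₀ hn₀ (b : G)⁻¹
    refine Eq.trans ?_ (hμinv ⟨_, hc⟩ (fun n => f (p (⟨h₀, hh₀⟩ * b) n)) fun n => hf _)
    refine congrArg μ (funext fun n => ?_)
    refine congrArg f (Subtype.ext ?_)
    simp [p, mul_assoc]

theorem HasInvariantMean.iSup_of_directed {G ι : Type*} [Group G] [Nonempty ι]
    [Preorder ι] [IsDirectedOrder ι] (H : ι → Subgroup G) (hmono : Monotone H)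
    (hH : ∀ i, HasInvariantMean (H i)) : HasInvariantMean (⨆ i, H i : Subgroup G) := by
  choose M hM hinv using hH
  refine .of_tendsto (atTop : Filter ι)
    (fun i f => M i fun x => f (Subgroup.inclusion (le_iSup H i) x)) (fun i => ⟨?_, ?_, ?_⟩) ?_
  · exact fun f hf => (hM i).mem_Icc _ fun x => hf _
  · exact (hM i).one
  · exact fun f g hf hg hfg => (hM i).add _ _ (fun x => hf _) (fun x => hg _) fun x => hfg _
  · rintro ⟨g, hg⟩ f hf
    obtain ⟨i₀, hi₀⟩ := (Subgroup.mem_iSup_of_directed hmono.directed_le).1 hg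
    refine tendsto_const_nhds.congr' ?_
    filter_upwards [eventually_ge_atTop i₀] with i hi
    refine (sub_eq_zero.2 ?_).symm
    exact hinv i ⟨g, hmono hi hi₀⟩ (fun x => f (Subgroup.inclusion (le_iSup H i) x))
      fun x => hf _

/-- A piecewise left translation with finitely many pieces preserves any finitely additive
left-invariant set function. -/
theorem measure_range_eq_univ {N : Type*} [Group N] {m : Set N → ℝ}
    (hadd : ∀ A B : Set N, Disjoint A B → m (A ∪ B) = m A + m B)
    (hinv : ∀ (g : N) (A : Set N), m ((fun x => g * x) '' A) = m A)
    (K : Finset N) (f : N → N) (hf : Function.Injective f) (hK : ∀ x, f x * x⁻¹ ∈ K) :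
    m (Set.range f) = m Set.univ := by
  classical
  suffices h : ∀ S : Finset N, m (f '' {x | f x * x⁻¹ ∈ S}) = m {x | f x * x⁻¹ ∈ S} by
    simpa [hK] using h K
  intro S
  induction S using Finset.induction_on with
  | empty => simp
  | insert k S hk ih =>
    have hset : {x | f x * x⁻¹ ∈ insert k S} =
        {x | f x * x⁻¹ = k} ∪ {x | f x * x⁻¹ ∈ S} := by
      ext x; simp
    have hdisj : Disjoint {x | f x * x⁻¹ = k} {x | f x * x⁻¹ ∈ S} := by
      rw [Set.disjoint_left]
      rintro x rfl
      exact hk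
    have himg : f '' {x | f x * x⁻¹ = k} = (fun x => k * x) '' {x | f x * x⁻¹ = k} := by
      refine Set.image_congr fun x hx => ?_
      rw [← show f x * x⁻¹ = k from hx]
      simp
    rw [hset, Set.image_union, hadd _ _ ((Set.disjoint_image_iff hf).2 hdisj),
      hadd _ _ hdisj, ih, himg, hinv]

/-- No finite subset of an amenable group doubles the size of every finite set. -/
theorem IsAmenable.exists_card_mul_lt {N : Type*} [Group N] [DecidableEq N] (h : IsAmenable N)
    (K : Finset N) : ∃ F : Finset N, (K * F).card < 2 * F.card := by
  obtain ⟨m, -, h1, hadd, hinv⟩ := h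
  by_contra! hcon
  obtain ⟨φ, hφ, hφK⟩ := (Finset.all_card_le_biUnion_card_iff_exists_injective
    fun x : N × Bool => K * {x.1}).1 fun s => by
      have hs : s ⊆ s.image Prod.fst ×ˢ Finset.univ := fun x hx =>
        Finset.mem_product.2 ⟨Finset.mem_image_of_mem _ hx, Finset.mem_univ _⟩
      calc s.card ≤ (s.image Prod.fst ×ˢ (Finset.univ : Finset Bool)).card :=
            Finset.card_le_card hs
        _ = 2 * (s.image Prod.fst).card := by simp [mul_comm]
        _ ≤ (K * s.image Prod.fst).card := hcon _
        _ ≤ _ := Finset.card_le_card fun y hy => by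
            obtain ⟨k, hk, z, hz, rfl⟩ := Finset.mem_mul.1 hy
            obtain ⟨x, hx, rfl⟩ := Finset.mem_image.1 hz
            exact Finset.mem_biUnion.2
              ⟨x, hx, Finset.mul_mem_mul hk (Finset.mem_singleton_self _)⟩
  obtain ⟨ψ, hψ, hψK⟩ := Function.Embedding.schroeder_bernstein_of_rel hφ
    (Prod.mk_left_injective true)
    (fun x y => y * x.1⁻¹ ∈ insert 1 K)
    (fun x => by
      obtain ⟨k, hk, z, hz, hx⟩ := Finset.mem_mul.1 (hφK x)
      rw [Finset.mem_singleton.1 hz] at hx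
      simp [← hx, hk])
    (fun y => by simp)
  have hr : ∀ b, m (Set.range fun x => ψ (x, b)) = m Set.univ := fun b =>
    measure_range_eq_univ hadd hinv (insert 1 K) _
      (hψ.1.comp (Prod.mk_left_injective b)) fun x => hψK _
  have hd : Disjoint (Set.range fun x => ψ (x, true)) (Set.range fun x => ψ (x, false)) := by
    rw [Set.disjoint_left]
    rintro _ ⟨x, rfl⟩ ⟨y, hy⟩
    simpa using hψ.1 hy
  have hu : (Set.range fun x => ψ (x, true)) ∪ (Set.range fun x => ψ (x, false)) =
      Set.univ := by
    refine Set.eq_univ_of_forall fun y => ?_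
    obtain ⟨⟨x, b⟩, rfl⟩ := hψ.2 y
    cases b
    · exact Or.inr ⟨x, rfl⟩
    · exact Or.inl ⟨x, rfl⟩
  have := hadd _ _ hd
  rw [hu, hr, hr, h1] at this
  norm_num at this

theorem IsAmenable.exists_card_mul_lt_mul {N : Type*} [Group N] [DecidableEq N]
    (h : IsAmenable N) (K : Finset N) {c : ℝ} (hc : 1 < c) :
    ∃ F : Finset N, ((K * F).card : ℝ) < c * F.card := by
  by_contra! hcon
  obtain ⟨p, hp⟩ := pow_unbounded_of_one_lt 2 hc
  have hpow : ∀ (q : ℕ) (F : Finset N), c ^ q * F.card ≤ ((K ^ q * F).card : ℝ) := by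
    intro q
    induction q with
    | zero => simp
    | succ q ih =>
      intro F
      calc c ^ (q + 1) * F.card = c ^ q * (c * F.card) := by ring
        _ ≤ c ^ q * ((K * F).card : ℝ) := by gcongr; exact hcon F
        _ ≤ _ := by rw [pow_succ, mul_assoc]; exact ih _
  obtain ⟨F, hF⟩ := h.exists_card_mul_lt (K ^ p)
  have h₁ : ((K ^ p * F).card : ℝ) < 2 * F.card := by exact_mod_cast hF
  have h₂ : (2 : ℝ) * F.card ≤ c ^ p * F.card := by gcongr
  linarith [hpow p F]

theorem isMean_average {X : Type*} (F : Finset X) (hF : F.Nonempty) :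
    IsMean fun f : X → ℝ => (∑ x ∈ F, f x) / F.card := by
  have hpos : (0 : ℝ) < F.card := by exact_mod_cast hF.card_pos
  refine ⟨fun f hf => ⟨?_, ?_⟩, ?_, ?_⟩
  · exact div_nonneg (Finset.sum_nonneg fun x _ => (hf x).1) hpos.le
  · rw [div_le_one hpos]
    simpa using Finset.sum_le_card_nsmul F f 1 fun x _ => (hf x).2
  · simp [hpos.ne']
  · intro f g _ _ _
    rw [Finset.sum_add_distrib, add_div]

theorem sum_le_sum_add_card_sub {X : Type*} {A B U : Finset X} (hA : A ⊆ U) (hB : B ⊆ U)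
    {f : X → ℝ} (hf : ∀ x, f x ∈ Set.Icc 0 1) :
    ∑ x ∈ A, f x ≤ ∑ x ∈ B, f x + (U.card - B.card) := by
  classical
  have h₁ : ∑ x ∈ A, f x ≤ ∑ x ∈ U, f x :=
    Finset.sum_le_sum_of_subset_of_nonneg hA fun x _ _ => (hf x).1
  have h₂ : ∑ x ∈ U \ B, f x ≤ ((U \ B).card : ℝ) := by
    simpa using Finset.sum_le_card_nsmul (U \ B) f 1 fun x _ => (hf x).2
  rw [Finset.cast_card_sdiff hB] at h₂
  linarith [Finset.sum_sdiff (f := f) hB]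

theorem IsAmenable.hasInvariantMean {N : Type*} [Group N] (h : IsAmenable N) :
    HasInvariantMean N := by
  classical
  have hc : ∀ i : Finset N × ℕ, (1 : ℝ) < 1 + 1 / ((i.2 : ℝ) + 1) := fun i => by
    have : (0 : ℝ) < 1 / ((i.2 : ℝ) + 1) := by positivity
    linarith
  choose F hF using fun i : Finset N × ℕ => h.exists_card_mul_lt_mul (insert 1 i.1) (hc i)
  have hne : ∀ i, (F i).Nonempty := fun i => by
    rw [Finset.nonempty_iff_ne_empty]
    intro hi
    simpa [hi] using hF i
  refine .of_tendsto (atTop : Filter (Finset N × ℕ))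
    (fun i f => (∑ x ∈ F i, f x) / (F i).card) (fun i => isMean_average _ (hne i)) ?_
  intro g f hf
  have hsnd : Tendsto (fun i : Finset N × ℕ => 1 / ((i.2 : ℝ) + 1)) atTop (𝓝 0) := by
    refine tendsto_one_div_add_atTop_nhds_zero_nat.comp ?_
    rw [← prod_atTop_atTop_eq]
    exact tendsto_snd
  refine squeeze_zero_norm' ?_ hsnd
  filter_upwards [eventually_ge_atTop (({g} : Finset N), 0)] with i hi
  have hg : g ∈ i.1 := hi.1 (Finset.mem_singleton_self g)
  have hpos : (0 : ℝ) < (F i).card := by exact_mod_cast (hne i).card_pos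
  have hsum : ∑ x ∈ F i, f (g * x) = ∑ x ∈ (F i).image (g * ·), f x :=
    (Finset.sum_image fun x _ y _ hxy => mul_left_cancel hxy).symm
  have hcard : ((F i).image (g * ·)).card = (F i).card :=
    Finset.card_image_of_injective _ (mul_right_injective g)
  have hA : F i ⊆ insert 1 i.1 * F i := fun x hx =>
    Finset.mem_mul.2 ⟨1, by simp, x, hx, one_mul x⟩
  have hB : (F i).image (g * ·) ⊆ insert 1 i.1 * F i := fun y hy => by
    obtain ⟨x, hx, rfl⟩ := Finset.mem_image.1 hy
    exact Finset.mul_mem_mul (Finset.mem_insert_of_mem hg) hx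
  have h₁ := sum_le_sum_add_card_sub hA hB hf
  have h₂ := sum_le_sum_add_card_sub hB hA hf
  rw [hcard] at h₁
  have h₃ := hF i
  rw [add_mul, one_mul] at h₃
  rw [hsum, ← sub_div, Real.norm_eq_abs, abs_div, abs_of_pos hpos, div_le_iff₀ hpos, abs_le]
  constructor <;> linarith

theorem isAmenable_of_subsingleton (N : Type*) [Group N] [Subsingleton N] : IsAmenable N := by
  refine HasInvariantMean.isAmenable ⟨fun f => f 1, ⟨fun f hf => hf 1, rfl, ?_⟩, ?_⟩
  · exact fun _ _ _ _ _ => rfl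
  · exact fun g f _ => congrArg f (Subsingleton.elim _ _)

/-- Every group possesses an amenable radical: a largest amenable normal subgroup. -/
theorem exists_amenable_radical (G : Type*) [Group G] :
    ∃ R : Subgroup G, IsAmenable R ∧ R.Normal ∧
      ∀ N : Subgroup G, IsAmenable N → N.Normal → N ≤ R := by
  let ι := {H : Subgroup G // IsAmenable H ∧ H.Normal}
  have : Nonempty ι := ⟨⟨⊥, isAmenable_of_subsingleton _, inferInstance⟩⟩
  have : IsDirectedOrder ι := ⟨fun H K => by
    have := H.2.2
    have := K.2.2
    exact ⟨⟨H.1 ⊔ K.1, (HasInvariantMean.sup H.1 K.1 H.2.1.hasInvariantMean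
      K.2.1.hasInvariantMean).isAmenable, inferInstance⟩, le_sup_left (b := K.1),
      le_sup_right (a := H.1)⟩⟩
  have : ∀ H : ι, H.1.Normal := fun H => H.2.2
  refine ⟨⨆ H : ι, H.1, ?_, inferInstance, fun N hN hN' => ?_⟩
  · exact (HasInvariantMean.iSup_of_directed (fun H : ι => H.1) (fun _ _ h => h)
      fun H => H.2.1.hasInvariantMean).isAmenable
  · exact le_iSup (fun H : ι => H.1) ⟨N, hN, hN'⟩
end

section
/- Let G be a countable group, let (N_n) be a sequence of amenable subgroups of G, and let N be a subgroup of G such that (N_n) converges pointwise to N. Then N is amenable. (Equivalently: the set of amenable subgroups of G is closed in the Chabauty topology on Sub(G).) -/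
/-- Every group retracts onto a subgroup compatibly with left translations. -/
theorem Subgroup.exists_leftEquivariant_retraction {G : Type*} [Group G] (H : Subgroup G) :
    ∃ r : G → H, ∀ (h : H) (x : G), r (h * x) = h * r x := by
  let q : G → Quotient (QuotientGroup.rightRel H) := Quotient.mk _
  have hq (x : G) : x * (q x).out⁻¹ ∈ H :=
    QuotientGroup.rightRel_apply.mp (Quotient.mk_out (s := QuotientGroup.rightRel H) x)
  refine ⟨fun x => ⟨x * (q x).out⁻¹, hq x⟩, fun h x => Subtype.ext ?_⟩
  have hqx : q (h * x) = q x := by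
    refine Quotient.sound (s := QuotientGroup.rightRel H) (QuotientGroup.rightRel_apply.mpr ?_)
    simp
  simp [hqx, mul_assoc]

/-- There is a linear functional on real sequences which takes the value `1` at the constant
sequence `1` and depends only on the germ of the sequence at infinity. -/
theorem exists_linearMap_germ_atTop :
    ∃ φ : (ℕ → ℝ) →ₗ[ℝ] ℝ, φ 1 = 1 ∧
      ∀ u v : ℕ → ℝ, u =ᶠ[Filter.atTop] v → φ u = φ v := by
  let W : Submodule ℝ (ℕ → ℝ) :=
    { carrier := {u | u =ᶠ[Filter.atTop] 0}
      zero_mem' := Filter.EventuallyEq.rfl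
      add_mem' := fun {u v} hu hv => by simpa using Filter.EventuallyEq.add hu hv
      smul_mem' := fun c u hu => by simpa using Filter.EventuallyEq.const_smul hu c }
  have h1 : (1 : ℕ → ℝ) ∉ W := fun h => by
    obtain ⟨n, hn⟩ := Filter.Eventually.exists (f := Filter.atTop) h
    exact one_ne_zero hn
  obtain ⟨f, hf, hW⟩ := Submodule.exists_le_ker_of_notMem h1
  refine ⟨(f 1)⁻¹ • f, by simp [hf], fun u v huv => ?_⟩
  have huv' : f (u - v) = 0 := hW (show u - v =ᶠ[Filter.atTop] 0 by
    filter_upwards [huv] with n hn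
    simp [hn])
  simp [sub_eq_zero.mp ((map_sub f u v).symm.trans huv')]

/-- A pointwise limit of amenable subgroups of a countable group is amenable:
the set of amenable subgroups is Chabauty closed. -/
theorem isAmenable_of_pointwise_limit
    (G : Type*) [Group G] [Countable G] (N : ℕ → Subgroup G) (L : Subgroup G)
    (ham : ∀ n, IsAmenable (N n))
    (hconv : ∀ g : G, ∃ n₀ : ℕ, ∀ n ≥ n₀, (g ∈ N n ↔ g ∈ L)) :
    IsAmenable L := by
  choose m h_empty h_univ h_union h_mul using ham
  choose r hr using fun n => (N n ⊓ L).exists_leftEquivariant_retraction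
  obtain ⟨φ, hφ, hgerm⟩ := exists_linearMap_germ_atTop
  let p (n : ℕ) (x : N n) : L := ⟨r n x, (r n x).2.2⟩
  refine ⟨fun A => φ fun n => m n (p n ⁻¹' A), ?_, ?_, fun A B hAB => ?_, fun g A => ?_⟩
  · simp only [Set.preimage_empty, h_empty]
    exact map_zero φ
  · simp only [Set.preimage_univ, h_univ]
    exact hφ
  · refine Eq.trans (congrArg φ ?_) (map_add φ _ _)
    funext n
    exact h_union n _ _ (hAB.preimage _)
  · refine hgerm _ _ ?_
    obtain ⟨n₀, hn₀⟩ := hconv g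
    filter_upwards [Filter.eventually_ge_atTop n₀] with n hn
    have hg : (g : G) ∈ N n := (hn₀ n hn).mpr g.2
    rw [← h_mul n ⟨g, hg⟩ (p n ⁻¹' A)]
    congr 1
    rw [Set.image_mul_left, Set.image_mul_left]
    ext x
    have hx : p n (⟨g, hg⟩⁻¹ * x) = g⁻¹ * p n x :=
      Subtype.ext (congrArg (fun y : ↥(N n ⊓ L) => (y : G)) (hr n ⟨g, hg, g.2⟩⁻¹ x))
    simp only [Set.mem_preimage, hx]
end

section
/- Let G be a countable group and fix g ∈ G. Suppose (H_n) is a sequence of subgroups of G converging pointwise to a subgroup H, and suppose that for every n there exists an amenable subgroup N_n of G with N_n normal in H_n and g ∈ N_n. Then there exists an amenable subgroup N of G with N normal in H and g ∈ N. (Equivalently: for each fixed g ∈ G, the set {H ∈ Sub(G) : g ∈ R_a(H)} is closed in the Chabauty topology, where R_a(H) denotes the amenable radical of H.) -/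
open Filter in
/-- A linear functional on real sequences that takes the value `1` on the constant sequence `1`
and only depends on the tail of a sequence. -/
theorem exists_linear_tail_functional :
    ∃ l : (ℕ → ℝ) →ₗ[ℝ] ℝ, l (fun _ => 1) = 1 ∧
      ∀ u v : ℕ → ℝ, u =ᶠ[atTop] v → l u = l v := by
  let W : Submodule ℝ (ℕ → ℝ) :=
    { carrier := {u | ∀ᶠ n in atTop, u n = 0}
      zero_mem' := Eventually.of_forall fun _ => rfl
      add_mem' := fun {u v} hu hv => by
        filter_upwards [hu, hv] with n h₁ h₂
        simp [h₁, h₂]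
      smul_mem' := fun c u hu => by
        filter_upwards [hu] with n h
        simp [h] }
  have hW : (fun _ => 1 : ℕ → ℝ) ∉ W := fun h => by
    obtain ⟨n, hn⟩ := Eventually.exists (f := atTop) h
    exact one_ne_zero hn
  obtain ⟨f, hf, hker⟩ := Submodule.exists_le_ker_of_notMem hW
  refine ⟨(f fun _ => 1)⁻¹ • f, by simp [hf], fun u v huv => ?_⟩
  have h : u - v ∈ W := by
    filter_upwards [huv] with n hn
    simp [hn]
  have h₀ : f (u - v) = 0 := hker h
  rw [map_sub, sub_eq_zero] at h₀
  simp [h₀]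

/-- `mu` is a finitely additive set function of total mass one on `G`. -/
def IsFinAddUnit {G : Type*} (mu : Set G → ℝ) : Prop :=
  mu ∅ = 0 ∧ mu Set.univ = 1 ∧ ∀ A B : Set G, Disjoint A B → mu (A ∪ B) = mu A + mu B

theorem IsFinAddUnit.comp_preimage {α β : Type*} {mu : Set α → ℝ} (hmu : IsFinAddUnit mu)
    (p : α → β) : IsFinAddUnit fun A : Set β => mu (p ⁻¹' A) :=
  ⟨hmu.1, hmu.2.1, fun _ _ hAB => hmu.2.2 _ _ (hAB.preimage p)⟩

/-- A subgroup is amenable iff the ambient group carries a finitely additive set function of total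
mass one that is invariant under left multiplication by the subgroup. -/
theorem isAmenable_subgroup_iff {G : Type*} [Group G] (N : Subgroup G) :
    IsAmenable N ↔ ∃ mu : Set G → ℝ, IsFinAddUnit mu ∧
      ∀ k ∈ N, ∀ A : Set G, mu ((fun x => k * x) '' A) = mu A := by
  constructor
  · rintro ⟨m, h₀, h₁, hadd, hinv⟩
    refine ⟨_, IsFinAddUnit.comp_preimage ⟨h₀, h₁, hadd⟩ Subtype.val, fun k hk A => ?_⟩
    rw [← hinv ⟨k, hk⟩ (Subtype.val ⁻¹' A)]
    congr 1
    ext x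
    simp [Set.image_mul_left]
  · rintro ⟨mu, hmu, hinv⟩
    obtain ⟨T, hT, -⟩ := N.exists_isComplement_right 1
    let p : G → N := fun x => (hT.equiv x).1
    have hp : ∀ (k : N) (x : G), p (k * x) = k * p x := fun k x =>
      congrArg Prod.fst (hT.equiv_mul_left k x)
    obtain ⟨h₀, h₁, hadd⟩ := hmu.comp_preimage p
    refine ⟨fun A => mu (p ⁻¹' A), h₀, h₁, hadd, fun k A => ?_⟩
    refine Eq.trans ?_ (hinv k k.2 (p ⁻¹' A))
    refine congrArg mu (Set.ext fun x => ?_)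
    have h : p ((k : G)⁻¹ * x) = k⁻¹ * p x := hp k⁻¹ x
    simp [Set.image_mul_left, h]

/-- The subgroup of elements that eventually belong to a sequence of subgroups. -/
def Subgroup.eventualSubgroup {G : Type*} [Group G] (N : ℕ → Subgroup G) : Subgroup G where
  carrier := {x | ∀ᶠ n in Filter.atTop, x ∈ N n}
  one_mem' := Filter.Eventually.of_forall fun n => (N n).one_mem
  mul_mem' hx hy := (hx.and hy).mono fun n h => (N n).mul_mem h.1 h.2
  inv_mem' hx := hx.mono fun n h => (N n).inv_mem h

theorem isAmenable_eventualSubgroup {G : Type*} [Group G] {N : ℕ → Subgroup G}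
    (hN : ∀ n, IsAmenable (N n)) : IsAmenable (Subgroup.eventualSubgroup N) := by
  simp only [isAmenable_subgroup_iff] at hN ⊢
  choose mu hmu hinv using hN
  obtain ⟨l, hl₁, hl⟩ := exists_linear_tail_functional
  refine ⟨fun A => l fun n => mu n A, ⟨?_, ?_, fun A B hAB => ?_⟩, fun k hk A => ?_⟩
  · simp only [(hmu _).1]
    exact map_zero l
  · simpa only [(hmu _).2.1] using hl₁
  · simp only [(hmu _).2.2 A B hAB]
    exact map_add l _ _
  · exact hl _ _ (Filter.Eventually.mono hk fun n hn => hinv n k hn A)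

/-- For fixed `g`, the set `{H : g ∈ R_a(H)}` is Chabauty closed: if `(H n) → H`
pointwise and each `H n` has an amenable normal subgroup containing `g`, then so
does `H`. -/
theorem mem_amenable_radical_closed
    (G : Type*) [Group G] [Countable G] (g : G) (H : ℕ → Subgroup G) (L : Subgroup G)
    (hconv : ∀ x : G, ∃ n₀ : ℕ, ∀ n ≥ n₀, (x ∈ H n ↔ x ∈ L))
    (hex : ∀ n : ℕ, ∃ N : Subgroup G, IsAmenable N ∧ N ≤ H n ∧
      (∀ h ∈ H n, ∀ t ∈ N, h * t * h⁻¹ ∈ N) ∧ g ∈ N) :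
    ∃ N : Subgroup G, IsAmenable N ∧ N ≤ L ∧
      (∀ h ∈ L, ∀ t ∈ N, h * t * h⁻¹ ∈ N) ∧ g ∈ N := by
  choose N hN hNH hnorm hg using hex
  refine ⟨Subgroup.eventualSubgroup N, isAmenable_eventualSubgroup hN, fun x hx => ?_,
    fun h hh t ht => ?_, Filter.Eventually.of_forall hg⟩
  · obtain ⟨n, hn, hiff⟩ :=
      (Filter.Eventually.and hx (Filter.eventually_atTop.2 (hconv x))).exists
    exact hiff.1 (hNH n hn)
  · exact (Filter.Eventually.and ht (Filter.eventually_atTop.2 (hconv h))).mono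
      fun n hn => hnorm n h (hn.2.2 hh) t hn.1
end

section
/- Let G be a countable group acting by homeomorphisms on a nonempty compact Hausdorff space X, and let μ be a probability measure on G (weights μ_g ≥ 0 with ∑_{g ∈ G} μ_g = 1). Then there exists a μ-stationary Borel probability measure ν on X, i.e., a regular Borel probability measure ν with ν = ∑_{g ∈ G} μ_g · g_*ν, where g_*ν denotes the pushforward of ν under the homeomorphism x ↦ g • x. -/
open MeasureTheory ENNReal

section Convolution

open Filter Topology CompactlySupported

variable {G X : Type*} [Group G] [MulAction G X]

/-- The convolution `∑ g, μ g • g_* ν`. -/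
noncomputable def stationaryConv [MeasurableSpace X] (μ : G → ℝ≥0∞) (ν : Measure X) : Measure X :=
  Measure.sum (fun g : G => μ g • ν.map (fun x : X => g • x))

theorem isProbabilityMeasure_stationaryConv [MeasurableSpace X]
    (hmeas : ∀ g : G, Measurable fun x : X => g • x)
    {μ : G → ℝ≥0∞} (hμ : ∑' g : G, μ g = 1) (ν : Measure X) [IsProbabilityMeasure ν] :
    IsProbabilityMeasure (stationaryConv μ ν) := by
  constructor
  rw [stationaryConv, Measure.sum_apply _ MeasurableSet.univ]
  simp [Measure.map_apply (hmeas _) MeasurableSet.univ, hμ]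

variable [TopologicalSpace X] [CompactSpace X] [MeasurableSpace X] [BorelSpace X]

theorem regular_stationaryConv [T2Space X] (hcont : ∀ g : G, Continuous fun x : X => g • x)
    (μ : G → ℝ≥0∞) (ν : Measure X) [ν.Regular]
    [IsFiniteMeasure (stationaryConv μ ν)] : (stationaryConv μ ν).Regular := by
  have (g : G) : (ν.map (fun x : X => g • x)).InnerRegular := by
    have : (ν.map (fun x : X => g • x)).Regular := Measure.Regular.map
      (⟨MulAction.toPerm g, hcont g, hcont g⁻¹⟩ : X ≃ₜ X)
    infer_instance
  have : (stationaryConv μ ν).InnerRegular := by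
    unfold stationaryConv
    infer_instance
  infer_instance

/-- The Markov operator `f ↦ ∑ g, μ g * f (g • ·)` is dual to convolution by `μ`. -/
theorem exists_integral_stationaryConv [Countable G]
    (hcont : ∀ g : G, Continuous fun x : X => g • x)
    {μ : G → ℝ≥0∞} (hμ : ∑' g : G, μ g = 1) (f : C_c(X, ℝ)) :
    ∃ Pf : C_c(X, ℝ), ∀ ν : Measure X, IsProbabilityMeasure ν →
      ∫ x, f x ∂(stationaryConv μ ν) = ∫ x, Pf x ∂ν := by
  obtain ⟨C, hC⟩ : ∃ C, ∀ x, ‖f x‖ ≤ C := by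
    simpa using isCompact_univ.exists_bound_of_continuousOn f.continuous.continuousOn
  have hsum : Summable fun g => (μ g).toReal := ENNReal.summable_toReal (by simp [hμ])
  have hfg (g : G) : Continuous fun x : X => (μ g).toReal * f (g • x) :=
    continuous_const.mul (f.continuous.comp (hcont g))
  have hbound (g : G) (x : X) : ‖(μ g).toReal * f (g • x)‖ ≤ (μ g).toReal * C := by
    rw [norm_mul, Real.norm_of_nonneg toReal_nonneg]
    exact mul_le_mul_of_nonneg_left (hC _) toReal_nonneg
  refine ⟨⟨⟨fun x => ∑' g, (μ g).toReal * f (g • x),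
    continuous_tsum hfg (hsum.mul_right C) hbound⟩, HasCompactSupport.of_compactSpace _⟩,
    fun ν hν => ?_⟩
  have hprob := isProbabilityMeasure_stationaryConv (fun g => (hcont g).measurable) hμ ν
  have hint (g : G) : Integrable (fun x : X => (μ g).toReal * f (g • x)) ν :=
    .of_bound (hfg g).aestronglyMeasurable _ (.of_forall (hbound g))
  have hf : Integrable f (stationaryConv μ ν) := f.integrable
  rw [stationaryConv, integral_sum_measure hf]
  simp only [integral_smul_measure]
  refine Eq.trans ?_ (integral_tsum_of_summable_integral_norm hint ?_)
  · refine tsum_congr fun g => ?_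
    rw [integral_map (f := f) (hcont g).aemeasurable f.continuous.aestronglyMeasurable,
      integral_const_mul, smul_eq_mul]
  · refine (hsum.mul_right C).of_nonneg_of_le (fun g => integral_nonneg fun x => norm_nonneg _)
      fun g => ?_
    simpa using integral_mono (hint g).norm (integrable_const _) (hbound g)

/-- An ultrafilter limit of Cesàro means represents a positive functional. -/
theorem exists_regular_tendsto_cesaro [T2Space X] (ν : ℕ → Measure X)
    (hν : ∀ n, IsProbabilityMeasure (ν n)) :
    ∃ m : Measure X, IsProbabilityMeasure m ∧ m.Regular ∧ ∀ f : C_c(X, ℝ),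
      Tendsto (fun n : ℕ => (n : ℝ)⁻¹ * ∑ k ∈ Finset.range n, ∫ x, f x ∂(ν k))
        (hyperfilter ℕ) (𝓝 (∫ x, f x ∂m)) := by
  set A : C_c(X, ℝ) → ℕ → ℝ :=
    fun f n => (n : ℝ)⁻¹ * ∑ k ∈ Finset.range n, ∫ x, f x ∂(ν k) with hA
  have hlim (f : C_c(X, ℝ)) : ∃ a, Tendsto (A f) (hyperfilter ℕ) (𝓝 a) := by
    obtain ⟨C, hC⟩ : ∃ C, ∀ x, ‖f x‖ ≤ C := by
      simpa using isCompact_univ.exists_bound_of_continuousOn f.continuous.continuousOn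
    have hC0 (k : ℕ) : ‖∫ x, f x ∂(ν k)‖ ≤ C := by
      simpa using norm_integral_le_of_norm_le_const (μ := ν k) (.of_forall hC)
    have hmem (n : ℕ) : A f n ∈ Metric.closedBall (0 : ℝ) C := by
      rw [mem_closedBall_zero_iff, hA, norm_mul, norm_inv, Real.norm_natCast]
      rcases n.eq_zero_or_pos with rfl | hn
      · simpa using (norm_nonneg _).trans (hC0 0)
      · rw [inv_mul_le_iff₀ (by positivity)]
        simpa using norm_sum_le_of_le (Finset.range n) fun k _ => hC0 k
    obtain ⟨a, -, ha⟩ := (isCompact_closedBall (0 : ℝ) C).ultrafilter_le_nhds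
      ((hyperfilter ℕ).map (A f)) (by
        exact tendsto_principal.mpr (.of_forall hmem))
    exact ⟨a, ha⟩
  choose L hL using hlim
  let Λ : C_c(X, ℝ) →ₚ[ℝ] ℝ := PositiveLinearMap.mk₀
    { toFun := L
      map_add' := fun f g => by
        refine tendsto_nhds_unique (hL (f + g)) (((hL f).add (hL g)).congr fun n => ?_)
        simp only [hA, CompactlySupportedContinuousMap.coe_add, Pi.add_apply]
        rw [← mul_add, ← Finset.sum_add_distrib]
        congr 1
        exact Finset.sum_congr rfl fun k _ => (integral_add f.integrable g.integrable).symm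
      map_smul' := fun c f => by
        refine tendsto_nhds_unique (hL (c • f)) (((hL f).const_mul c).congr fun n => ?_)
        simp only [hA, CompactlySupportedContinuousMap.coe_smul, Pi.smul_apply, smul_eq_mul,
          integral_const_mul, ← Finset.mul_sum]
        ring }
    (fun f hf => ge_of_tendsto' (hL f) fun n => mul_nonneg (by positivity)
      (Finset.sum_nonneg fun k _ => integral_nonneg hf))
  have hΛ (f : C_c(X, ℝ)) : ∫ x, f x ∂(RealRMK.rieszMeasure Λ) = L f :=
    RealRMK.integral_rieszMeasure Λ f
  refine ⟨RealRMK.rieszMeasure Λ, ?_, inferInstance, fun f => hΛ f ▸ hL f⟩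
  let o : C_c(X, ℝ) := ⟨1, HasCompactSupport.of_compactSpace _⟩
  have ho : L o = 1 := by
    refine tendsto_nhds_unique (hL o) (tendsto_const_nhds.congr' ?_)
    have : ∀ᶠ n in (hyperfilter ℕ : Filter ℕ), 1 ≤ n :=
      Nat.hyperfilter_le_atTop (eventually_ge_atTop 1)
    filter_upwards [this] with n hn
    have : (n : ℝ) ≠ 0 := by positivity
    simp [hA, o, this]
  have hreal := (hΛ o).trans ho
  have : (RealRMK.rieszMeasure Λ).real Set.univ = 1 := by simpa [o] using hreal
  exact ⟨by simpa [Measure.real, ENNReal.toReal_eq_one_iff] using this⟩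

end Convolution

/-- For a countable group acting by homeomorphisms on a nonempty compact
Hausdorff space and a probability measure `μ` on the group, there exists a
`μ`-stationary regular Borel probability measure on the space. -/
theorem exists_stationary_measure
    (G : Type*) [Group G] [Countable G]
    (X : Type*) [TopologicalSpace X] [CompactSpace X] [T2Space X] [Nonempty X]
    [MeasurableSpace X] [BorelSpace X]
    [MulAction G X] (hcont : ∀ g : G, Continuous fun x : X => g • x)
    (μ : G → ℝ≥0∞) (hμ : ∑' g : G, μ g = 1) :
    ∃ ν : Measure X, IsProbabilityMeasure ν ∧ ν.Regular ∧
      ν = Measure.sum (fun g : G => μ g • ν.map (fun x : X => g • x)) := by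
  have hT := isProbabilityMeasure_stationaryConv (fun g => (hcont g).measurable) hμ
  let ν : ℕ → Measure X := fun n => (stationaryConv μ)^[n] (Measure.dirac (Classical.arbitrary X))
  have hν_succ (n : ℕ) : ν (n + 1) = stationaryConv μ (ν n) := Function.iterate_succ_apply' _ _ _
  have hν (n : ℕ) : IsProbabilityMeasure (ν n) := by
    induction n with
    | zero => exact Measure.dirac.isProbabilityMeasure
    | succ n ih => exact hν_succ n ▸ hT (ν n)
  obtain ⟨m, hm, hmreg, hlim⟩ := exists_regular_tendsto_cesaro ν hν
  have hTm := hT m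
  have hTreg := regular_stationaryConv hcont μ m
  refine ⟨m, hm, hmreg, ?_⟩
  change m = stationaryConv μ m
  refine Measure.ext_of_integral_eq_on_compactlySupported fun f => ?_
  obtain ⟨Pf, hPf⟩ := exists_integral_stationaryConv hcont hμ f
  rw [hPf m hm]
  obtain ⟨C, hC⟩ : ∃ C, ∀ x, ‖f x‖ ≤ C := by
    simpa using isCompact_univ.exists_bound_of_continuousOn f.continuous.continuousOn
  have hint (k : ℕ) : ‖∫ x, f x ∂(ν k)‖ ≤ C := by
    simpa using norm_integral_le_of_norm_le_const (μ := ν k) (.of_forall hC)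
  have hzero : Filter.Tendsto
      (fun n : ℕ => (n : ℝ)⁻¹ * (∫ x, f x ∂(ν n) - ∫ x, f x ∂(ν 0))) Filter.atTop (nhds 0) :=
    tendsto_inv_atTop_nhds_zero_nat.zero_mul_isBoundedUnder_le
      (Filter.isBoundedUnder_of ⟨C + C, fun n => norm_sub_le_of_le (hint n) (hint 0)⟩)
  have hdiff := (hlim Pf).sub (hlim f)
  refine (sub_eq_zero.mp (tendsto_nhds_unique hdiff
    ((hzero.mono_left Nat.hyperfilter_le_atTop).congr fun n => ?_))).symm
  rw [← mul_sub, ← Finset.sum_sub_distrib,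
    ← Finset.sum_range_sub (fun k => ∫ x, f x ∂(ν k))]
  simp only [hν_succ, hPf _ (hν _)]
end

section
/- Let G be a countable group acting by homeomorphisms on an infinite compact Hausdorff space X, and assume the action is minimal (every orbit is dense). Let μ be a probability measure on G that is generating (the semigroup generated by {g ∈ G : μ_g > 0} is all of G), and let ν be a μ-stationary Borel probability measure on X. Then ν is atomless: ν({x}) = 0 for every x ∈ X. -/
open MeasureTheory ENNReal

/-- The atoms of mass at least `c > 0` of a finite measure form a finite set. -/
lemma finite_setOf_le_measure_singleton {X : Type*} [MeasurableSpace X]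
    [MeasurableSingletonClass X] (ν : Measure X) [IsFiniteMeasure ν]
    {c : ℝ≥0∞} (hc : 0 < c) : {y : X | c ≤ ν {y}}.Finite :=
  Measure.finite_const_le_meas_of_disjoint_iUnion ν hc
    (fun y => measurableSet_singleton y)
    (fun _ _ h => Set.disjoint_singleton.2 h) (measure_ne_top _ _)

/-- If a weighted average of values bounded by `m` equals `m`, every value of
positive weight equals `m`. -/
lemma eq_of_tsum_mul_eq {ι : Type*} {w f : ι → ℝ≥0∞} {m : ℝ≥0∞} (hm : m ≠ ∞)
    (hw : ∑' i, w i = 1) (hf : ∀ i, f i ≤ m) (h : ∑' i, w i * f i = m)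
    {i : ι} (hi : 0 < w i) : f i = m := by
  by_contra hne
  have hwi : w i ≠ ∞ := ne_top_of_le_ne_top one_ne_top (hw ▸ ENNReal.le_tsum i)
  have hlt : ∑' j, w j * f j < ∑' j, w j * m :=
    ENNReal.tsum_lt_tsum (h.symm ▸ hm) (fun j => mul_le_mul_right (hf j) _)
      (ENNReal.mul_lt_mul_right hi.ne' hwi (lt_of_le_of_ne (hf i) hne))
  rw [h, ENNReal.tsum_mul_right, hw, one_mul] at hlt
  exact hlt.false

/-- A stationary measure of a minimal action on an infinite compact Hausdorff
space, with respect to a generating probability measure on the group, is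
atomless. -/
theorem stationary_measure_atomless
    (G : Type*) [Group G] [Countable G]
    (X : Type*) [TopologicalSpace X] [CompactSpace X] [T2Space X] [Infinite X]
    [MeasurableSpace X] [BorelSpace X]
    [MulAction G X] (hcont : ∀ g : G, Continuous fun x : X => g • x)
    (hmin : ∀ x : X, Dense (MulAction.orbit G x))
    (μ : G → ℝ≥0∞) (hμ : ∑' g : G, μ g = 1)
    (hgen : Subsemigroup.closure {g : G | 0 < μ g} = ⊤)
    (ν : Measure X) (hprob : IsProbabilityMeasure ν)
    (hstat : ν = Measure.sum (fun g : G => μ g • ν.map (fun x : X => g • x))) :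
    ∀ x : X, ν {x} = 0 := by
  intro x
  by_contra hx
  have hfin := finite_setOf_le_measure_singleton ν (pos_iff_ne_zero.2 hx)
  obtain ⟨y₀, hy₀, hmax⟩ := hfin.exists_maximalFor (fun y => ν {y}) _ ⟨x, le_refl (ν {x})⟩
  have hle : ∀ y, ν {y} ≤ ν {y₀} := fun y =>
    (le_total (ν {y}) (ν {y₀})).elim id fun h => hmax (le_trans hy₀ h) h
  have hatom : ∀ y, ∑' g : G, μ g * ν {g⁻¹ • y} = ν {y} := by
    intro y
    conv_rhs => rw [hstat]
    rw [Measure.sum_apply _ (measurableSet_singleton y)]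
    refine tsum_congr fun g => ?_
    rw [Measure.smul_apply, smul_eq_mul,
      Measure.map_apply (hcont g).measurable (measurableSet_singleton y)]
    congr 2
    ext z
    simp [eq_inv_smul_iff]
  have hinv : ∀ g : G, ∀ y, ν {y} = ν {y₀} → ν {g⁻¹ • y} = ν {y₀} := by
    intro g
    have hg : g ∈ Subsemigroup.closure {g : G | 0 < μ g} := hgen ▸ Subsemigroup.mem_top g
    induction hg using Subsemigroup.closure_induction with
    | mem g hg =>
      intro y hy
      exact eq_of_tsum_mul_eq (f := fun g : G => ν {g⁻¹ • y}) (measure_ne_top _ _) hμ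
        (fun _ => hle _) ((hatom y).trans hy) hg
    | mul g h _ _ ihg ihh =>
      intro y hy
      rw [mul_inv_rev, mul_smul]
      exact ihh _ (ihg y hy)
  have horbit : (MulAction.orbit G y₀).Finite := by
    refine hfin.subset ?_
    rintro _ ⟨g, rfl⟩
    have hg := hinv g⁻¹ y₀ rfl
    rw [inv_inv] at hg
    exact le_trans hy₀ hg.ge
  have huniv := (hmin y₀).closure_eq
  rw [horbit.isClosed.closure_eq] at huniv
  exact Set.infinite_univ (huniv ▸ horbit)
end
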